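/- Let B' be the set of pairs (f, g) ∈ C(I × I, ℂ) × C(I × I, ℂ) satisfying f(s,1) = f(1,t) = g(s,1) = g(1,t) = 0 for all s, t ∈ I, f(0,t) = conj(g(0,t)) for all t ∈ I, and f(s,0) = g(s,0) for all s ∈ I, with componentwise operations and star. Let B = {h ∈ C(I × I, ℂ) : h(s,0) = h(s,1) = 0 for all s, h(1,t) = 0 for all t, and h(0,t) = conj(h(0,1−t)) for all t}. Then the pasting map Φ sending (f, g) to the function h defined by h(s,t) = g(s, 1−2t) for t ≤ 1/2 and h(s,t) = f(s, 2t−1) for t ≥ 1/2 is well defined (the two formulas agree at t = 1/2 and h is continuous), takes values in B, and is a star ℝ-algebra isomorphism from B' onto B. -/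

import Mathlib

/-- `B'`: pairs `(f, g)` with `f(s,1) = f(1,t) = g(s,1) = g(1,t) = 0`,
`f(0,t) = conj (g(0,t))` and `f(s,0) = g(s,0)`. -/
def B' : Set (C(unitInterval × unitInterval, ℂ) × C(unitInterval × unitInterval, ℂ)) :=
  {p | (∀ s : unitInterval, p.1 (s, 1) = 0) ∧
       (∀ t : unitInterval, p.1 (1, t) = 0) ∧
       (∀ s : unitInterval, p.2 (s, 1) = 0) ∧
       (∀ t : unitInterval, p.2 (1, t) = 0) ∧
       (∀ t : unitInterval, p.1 (0, t) = (starRingEnd ℂ) (p.2 (0, t))) ∧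
       (∀ s : unitInterval, p.1 (s, 0) = p.2 (s, 0))}

/-- `B = {h ∈ C(I × I, ℂ) : h(s,0) = h(s,1) = h(1,t) = 0, h(0,t) = conj (h(0,1−t))}`. -/
def Bset : Set C(unitInterval × unitInterval, ℂ) :=
  {h | (∀ s : unitInterval, h (s, 0) = 0) ∧
       (∀ s : unitInterval, h (s, 1) = 0) ∧
       (∀ t : unitInterval, h (1, t) = 0) ∧
       (∀ t : unitInterval, h (0, t) = (starRingEnd ℂ) (h (0, unitInterval.symm t)))}

open unitInterval in
/-- The map `t ↦ 1 - 2 t`, clamped to the unit interval. -/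
noncomputable def lowerHalf (t : I) : I :=
  Set.projIcc 0 1 zero_le_one (1 - 2 * (t : ℝ))

open unitInterval in
/-- The map `t ↦ 2 t - 1`, clamped to the unit interval. -/
noncomputable def upperHalf (t : I) : I :=
  Set.projIcc 0 1 zero_le_one (2 * (t : ℝ) - 1)

theorem continuous_lowerHalf : Continuous lowerHalf :=
  continuous_projIcc.comp (by fun_prop)

theorem continuous_upperHalf : Continuous upperHalf :=
  continuous_projIcc.comp (by fun_prop)

theorem lowerHalf_eq {t t' : unitInterval} (h : (t' : ℝ) = 1 - 2 * (t : ℝ)) :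
    lowerHalf t = t' := by
  rw [lowerHalf, ← h, Set.projIcc_val]

theorem upperHalf_eq {t t' : unitInterval} (h : (t' : ℝ) = 2 * (t : ℝ) - 1) :
    upperHalf t = t' := by
  rw [upperHalf, ← h, Set.projIcc_val]

/-- The function obtained by pasting `g` (reversed, on the lower half) and `f` (on the upper half)
along the common edge. -/
noncomputable def pasteHalves (f g : C(unitInterval × unitInterval, ℂ))
    (hfg : ∀ s, f (s, 0) = g (s, 0)) : C(unitInterval × unitInterval, ℂ) where
  toFun x := if (x.2 : ℝ) ≤ 1 / 2 then g (x.1, lowerHalf x.2) else f (x.1, upperHalf x.2)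
  continuous_toFun := by
    have hl := continuous_lowerHalf
    have hu := continuous_upperHalf
    refine Continuous.if_le (by fun_prop) (by fun_prop) (by fun_prop) (by fun_prop) ?_
    intro x hx
    have h1 : lowerHalf x.2 = 0 := lowerHalf_eq (by rw [hx]; norm_num)
    have h2 : upperHalf x.2 = 0 := upperHalf_eq (by rw [hx]; norm_num)
    rw [h1, h2, hfg]

section pasteHalves

variable {f g : C(unitInterval × unitInterval, ℂ)} (hfg : ∀ s, f (s, 0) = g (s, 0))

theorem pasteHalves_apply (x : unitInterval × unitInterval) :
    pasteHalves f g hfg x =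
      if (x.2 : ℝ) ≤ 1 / 2 then g (x.1, lowerHalf x.2) else f (x.1, upperHalf x.2) :=
  rfl

theorem pasteHalves_of_le (s : unitInterval) {t t' : unitInterval} (ht : (t : ℝ) ≤ 1 / 2)
    (h : (t' : ℝ) = 1 - 2 * (t : ℝ)) : pasteHalves f g hfg (s, t) = g (s, t') := by
  rw [pasteHalves_apply, if_pos ht, lowerHalf_eq h]

theorem pasteHalves_of_ge (s : unitInterval) {t t' : unitInterval} (ht : 1 / 2 ≤ (t : ℝ))
    (h : (t' : ℝ) = 2 * (t : ℝ) - 1) : pasteHalves f g hfg (s, t) = f (s, t') := by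
  rcases ht.eq_or_lt with ht | ht
  · have h0 : t' = 0 := Subtype.ext (by rw [h, ← ht]; norm_num)
    rw [h0, hfg]
    exact pasteHalves_of_le hfg s ht.ge (by rw [← ht]; norm_num)
  · rw [pasteHalves_apply, if_neg ht.not_ge, upperHalf_eq h]

end pasteHalves

theorem pasteHalves_mem {p : C(unitInterval × unitInterval, ℂ) × C(unitInterval × unitInterval, ℂ)}
    (hp : p ∈ B') : pasteHalves p.1 p.2 hp.2.2.2.2.2 ∈ Bset := by
  obtain ⟨hf1, hf2, hg1, hg2, hc, h0⟩ := hp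
  refine ⟨fun s => ?_, fun s => ?_, fun t => ?_, fun t => ?_⟩
  · rw [pasteHalves_of_le h0 s (t' := 1) (by norm_num) (by norm_num), hg1]
  · rw [pasteHalves_of_ge h0 s (t' := 1) (by norm_num) (by norm_num), hf1]
  · rw [pasteHalves_apply, hf2, hg2, ite_self]
  · rcases le_total (t : ℝ) (1 / 2) with ht | ht
    · have hu : 1 - 2 * (t : ℝ) ∈ unitInterval := ⟨by linarith, by linarith [t.2.1]⟩
      rw [pasteHalves_of_le h0 0 (t' := ⟨_, hu⟩) ht rfl,
        pasteHalves_of_ge h0 0 (t' := ⟨_, hu⟩) (by rw [unitInterval.coe_symm_eq]; linarith)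
          (by rw [unitInterval.coe_symm_eq]; ring), hc, Complex.conj_conj]
    · have hu : 2 * (t : ℝ) - 1 ∈ unitInterval := ⟨by linarith, by linarith [t.2.2]⟩
      rw [pasteHalves_of_ge h0 0 (t' := ⟨_, hu⟩) ht rfl,
        pasteHalves_of_le h0 0 (t' := ⟨_, hu⟩) (by rw [unitInterval.coe_symm_eq]; linarith)
          (by rw [unitInterval.coe_symm_eq]; ring), hc]

theorem half_one_sub_mem (u : unitInterval) : (1 - (u : ℝ)) / 2 ∈ unitInterval :=
  ⟨by linarith [u.2.2], by linarith [u.2.1]⟩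

theorem half_one_add_mem (u : unitInterval) : (1 + (u : ℝ)) / 2 ∈ unitInterval :=
  ⟨by linarith [u.2.1], by linarith [u.2.2]⟩

/-- The restriction of `h` to the lower half of the square, reversed and rescaled. -/
noncomputable def restrictLower (h : C(unitInterval × unitInterval, ℂ)) :
    C(unitInterval × unitInterval, ℂ) where
  toFun x := h (x.1, ⟨(1 - (x.2 : ℝ)) / 2, half_one_sub_mem x.2⟩)
  continuous_toFun := by fun_prop

/-- The restriction of `h` to the upper half of the square, rescaled. -/
noncomputable def restrictUpper (h : C(unitInterval × unitInterval, ℂ)) :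
    C(unitInterval × unitInterval, ℂ) where
  toFun x := h (x.1, ⟨(1 + (x.2 : ℝ)) / 2, half_one_add_mem x.2⟩)
  continuous_toFun := by fun_prop

theorem restrictLower_apply (h : C(unitInterval × unitInterval, ℂ)) (s : unitInterval)
    {t t' : unitInterval} (ht : (t' : ℝ) = (1 - (t : ℝ)) / 2) :
    restrictLower h (s, t) = h (s, t') :=
  congrArg (fun u => h (s, u)) (Subtype.ext ht.symm)

theorem restrictUpper_apply (h : C(unitInterval × unitInterval, ℂ)) (s : unitInterval)
    {t t' : unitInterval} (ht : (t' : ℝ) = (1 + (t : ℝ)) / 2) :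
    restrictUpper h (s, t) = h (s, t') :=
  congrArg (fun u => h (s, u)) (Subtype.ext ht.symm)

theorem restrict_mem {h : C(unitInterval × unitInterval, ℂ)} (hh : h ∈ Bset) :
    (restrictUpper h, restrictLower h) ∈ B' := by
  obtain ⟨h0, h1, hr, hc⟩ := hh
  refine ⟨fun s => ?_, fun t => hr _, fun s => ?_, fun t => hr _, fun t => ?_, fun s => ?_⟩
  · exact (restrictUpper_apply h s (t' := 1) (by norm_num)).trans (h1 s)
  · exact (restrictLower_apply h s (t' := 0) (by norm_num)).trans (h0 s)
  · refine (hc _).trans (congrArg _ (restrictLower_apply h 0 ?_).symm)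
    rw [unitInterval.coe_symm_eq]
    ring
  · refine (restrictLower_apply h s ?_).symm
    norm_num

theorem pasteHalves_restrict {h : C(unitInterval × unitInterval, ℂ)}
    (hfg : ∀ s, restrictUpper h (s, 0) = restrictLower h (s, 0)) :
    pasteHalves (restrictUpper h) (restrictLower h) hfg = h := by
  ext ⟨s, t⟩
  rcases le_total (t : ℝ) (1 / 2) with ht | ht
  · have hu : 1 - 2 * (t : ℝ) ∈ unitInterval := ⟨by linarith, by linarith [t.2.1]⟩
    rw [pasteHalves_of_le hfg s (t' := ⟨_, hu⟩) ht rfl]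
    exact restrictLower_apply h s (by ring)
  · have hu : 2 * (t : ℝ) - 1 ∈ unitInterval := ⟨by linarith, by linarith [t.2.2]⟩
    rw [pasteHalves_of_ge hfg s (t' := ⟨_, hu⟩) ht rfl]
    exact restrictUpper_apply h s (by ring)

theorem restrictUpper_pasteHalves {f g : C(unitInterval × unitInterval, ℂ)}
    (hfg : ∀ s, f (s, 0) = g (s, 0)) : restrictUpper (pasteHalves f g hfg) = f := by
  ext ⟨s, u⟩
  exact pasteHalves_of_ge hfg s (by linarith [u.2.1]) (by ring)

theorem restrictLower_pasteHalves {f g : C(unitInterval × unitInterval, ℂ)}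
    (hfg : ∀ s, f (s, 0) = g (s, 0)) : restrictLower (pasteHalves f g hfg) = g := by
  ext ⟨s, u⟩
  exact pasteHalves_of_le hfg s (by linarith [u.2.1]) (by ring)

/-- Pasting is a bijection from `B'` onto `B`, with inverse the restriction to the two halves. -/
noncomputable def pasteEquiv : ↥B' ≃ ↥Bset where
  toFun p := ⟨pasteHalves p.1.1 p.1.2 p.2.2.2.2.2.2, pasteHalves_mem p.2⟩
  invFun h := ⟨(restrictUpper h.1, restrictLower h.1), restrict_mem h.2⟩
  left_inv p := Subtype.ext (Prod.ext (restrictUpper_pasteHalves p.2.2.2.2.2.2)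
    (restrictLower_pasteHalves p.2.2.2.2.2.2))
  right_inv h := Subtype.ext (pasteHalves_restrict (restrict_mem h.2).2.2.2.2.2)

theorem pasteEquiv_apply (p : ↥B') (x : unitInterval × unitInterval) :
    (pasteEquiv p : C(unitInterval × unitInterval, ℂ)) x =
      if (x.2 : ℝ) ≤ 1 / 2 then p.1.2 (x.1, lowerHalf x.2) else p.1.1 (x.1, upperHalf x.2) :=
  rfl

/-- The pasting map `(f, g) ↦ h`, `h(s,t) = g(s, 1−2t)` for `t ≤ 1/2` and
`h(s,t) = f(s, 2t−1)` for `t ≥ 1/2`, is a well-defined star `ℝ`-algebra isomorphism from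
`B'` onto `B`. -/
theorem stmt_7 :
    ∃ Φ : ↥B' → ↥Bset,
      (∀ (p : ↥B') (s t t' : unitInterval),
        ((t : ℝ) ≤ 1 / 2 → (t' : ℝ) = 1 - 2 * (t : ℝ) →
          (Φ p : C(unitInterval × unitInterval, ℂ)) (s, t) = p.val.2 (s, t')) ∧
        (1 / 2 ≤ (t : ℝ) → (t' : ℝ) = 2 * (t : ℝ) - 1 →
          (Φ p : C(unitInterval × unitInterval, ℂ)) (s, t) = p.val.1 (s, t'))) ∧
      Function.Bijective Φ ∧
      (∀ (p q : C(unitInterval × unitInterval, ℂ) × C(unitInterval × unitInterval, ℂ))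
          (hp : p ∈ B') (hq : q ∈ B') (h : p + q ∈ B'),
        (Φ ⟨p + q, h⟩ : C(unitInterval × unitInterval, ℂ)) =
          (Φ ⟨p, hp⟩ : C(unitInterval × unitInterval, ℂ)) +
            (Φ ⟨q, hq⟩ : C(unitInterval × unitInterval, ℂ))) ∧
      (∀ (r : ℝ) (p : C(unitInterval × unitInterval, ℂ) × C(unitInterval × unitInterval, ℂ))
          (hp : p ∈ B') (h : r • p ∈ B'),
        (Φ ⟨r • p, h⟩ : C(unitInterval × unitInterval, ℂ)) =
          r • (Φ ⟨p, hp⟩ : C(unitInterval × unitInterval, ℂ))) ∧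
      (∀ (p q : C(unitInterval × unitInterval, ℂ) × C(unitInterval × unitInterval, ℂ))
          (hp : p ∈ B') (hq : q ∈ B') (h : p * q ∈ B'),
        (Φ ⟨p * q, h⟩ : C(unitInterval × unitInterval, ℂ)) =
          (Φ ⟨p, hp⟩ : C(unitInterval × unitInterval, ℂ)) *
            (Φ ⟨q, hq⟩ : C(unitInterval × unitInterval, ℂ))) ∧
      (∀ (p : C(unitInterval × unitInterval, ℂ) × C(unitInterval × unitInterval, ℂ))
          (hp : p ∈ B') (h : star p ∈ B'),
        (Φ ⟨star p, h⟩ : C(unitInterval × unitInterval, ℂ)) =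
          star (Φ ⟨p, hp⟩ : C(unitInterval × unitInterval, ℂ))) := by
  refine ⟨pasteEquiv, fun p s t t' => ⟨pasteHalves_of_le p.2.2.2.2.2.2 s,
    pasteHalves_of_ge p.2.2.2.2.2.2 s⟩, pasteEquiv.bijective, ?_, ?_, ?_, ?_⟩
  · intro p q hp hq h
    ext x
    simp only [pasteEquiv_apply, ContinuousMap.add_apply, Prod.fst_add, Prod.snd_add]
    split_ifs <;> rfl
  · intro r p hp h
    ext x
    simp only [pasteEquiv_apply, ContinuousMap.smul_apply, Prod.smul_fst, Prod.smul_snd]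
    split_ifs <;> rfl
  · intro p q hp hq h
    ext x
    simp only [pasteEquiv_apply, ContinuousMap.mul_apply, Prod.fst_mul, Prod.snd_mul]
    split_ifs <;> rfl
  · intro p hp h
    ext x
    simp only [pasteEquiv_apply, ContinuousMap.star_apply, Prod.fst_star, Prod.snd_star]
    split_ifs <;> rfl
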